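/- Let f = (f₁, f₂) : [x⁻, x⁺] × [y⁻, y⁺] → ℝ² be continuous on the rectangle R = [x⁻, x⁺] × [y⁻, y⁺], and assume: (1) both f₁ and f₂ are strictly negative on the two sides {x⁻} × [y⁻, y⁺] and [x⁻, x⁺] × {y⁻}; (2) f₁(x⁺, y⁺) > 0 and f₂(x⁺, y⁺) > 0; (3) max{x ∈ [x⁻, x⁺] : f₁(x, y⁺) = 0} < min{x ∈ [x⁻, x⁺] : f₂(x, y⁺) = 0}; (4) max{y ∈ [y⁻, y⁺] : f₂(x⁺, y) = 0} < min{y ∈ [y⁻, y⁺] : f₁(x⁺, y) = 0}. Then there exists a point (x, y) ∈ R with f₁(x, y) = 0 and f₂(x, y) = 0. -/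

import Mathlib

open Set in
/-- Along a preconnected set on which `exp ∘ g` stays in the slit plane, the increment of a
continuous `g` is the increment of the principal logarithm of `exp ∘ g`. -/
theorem IsPreconnected.sub_eq_log_exp_sub {X : Type*} [TopologicalSpace X] {S : Set X}
    (hS : IsPreconnected S) {g : X → ℂ} (hg : ContinuousOn g S)
    (hmaps : ∀ x ∈ S, Complex.exp (g x) ∈ Complex.slitPlane) {a b : X} (ha : a ∈ S) (hb : b ∈ S) :
    g b - g a = Complex.log (Complex.exp (g b)) - Complex.log (Complex.exp (g a)) := by
  have hlog : ContinuousOn (fun x => Complex.log (Complex.exp (g x))) S :=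
    (Complex.continuous_exp.comp_continuousOn hg).clog hmaps
  have hdiscrete : IsDiscrete (range ((↑) : ℤ → ℝ)) :=
    ⟨Int.isClosedEmbedding_coe_real.isEmbedding.toHomeomorph.symm.isEmbedding.discreteTopology⟩
  have hint : ∀ x, ∃ n : ℤ, g x - Complex.log (Complex.exp (g x)) =
      n * (2 * Real.pi * Complex.I) := fun x => by
    obtain ⟨n, hn⟩ := Complex.exp_eq_exp_iff_exists_int.1
      (Complex.exp_log (Complex.exp_ne_zero (g x))).symm
    exact ⟨n, by linear_combination hn⟩
  have hconst := hS.constant_of_mapsTo hdiscrete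
    (f := fun x => ((g x - Complex.log (Complex.exp (g x))) / (2 * Real.pi * Complex.I)).re)
    (Complex.continuous_re.comp_continuousOn ((hg.sub hlog).div_const _))
    (fun x _ => by
      obtain ⟨n, hn⟩ := hint x
      exact ⟨n, by simp [hn]⟩) ha hb
  obtain ⟨n, hn⟩ := hint a
  obtain ⟨m, hm⟩ := hint b
  have hnm : (n : ℝ) = m := by simpa [hn, hm, Complex.two_pi_I_ne_zero] using hconst
  have hnm' : (n : ℂ) = m := by exact_mod_cast hnm
  linear_combination hm - hn - (2 * Real.pi * Complex.I) * hnm'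

/-- Two real functions on a simply connected space have a common zero if two connected sets join
a point where both are negative to a point where both are positive, the pair of functions avoiding
the fourth open quadrant on the first set and the second open quadrant on the other. -/
theorem exists_common_zero_of_isPreconnected {X : Type*} [TopologicalSpace X]
    [SimplyConnectedSpace X] [LocallyPathConnectedSpace X] {f₁ f₂ : X → ℝ}
    (hf₁ : Continuous f₁) (hf₂ : Continuous f₂) {S T : Set X}
    (hS : IsPreconnected S) (hT : IsPreconnected T)
    (hfS : ∀ x ∈ S, 0 < f₁ x → 0 ≤ f₂ x) (hfT : ∀ x ∈ T, 0 < f₂ x → 0 ≤ f₁ x)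
    {a b : X} (haS : a ∈ S) (hbS : b ∈ S) (haT : a ∈ T) (hbT : b ∈ T)
    (ha₁ : f₁ a < 0) (ha₂ : f₂ a < 0) (hb₁ : 0 < f₁ b) (hb₂ : 0 < f₂ b) :
    ∃ x, f₁ x = 0 ∧ f₂ x = 0 := by
  by_contra! hne
  -- In these coordinates the excluded quadrants contain the negative and positive real axes.
  let h : X → ℂ := fun x => ((f₂ x - f₁ x : ℝ) : ℂ) + ((-(f₁ x + f₂ x) : ℝ) : ℂ) * Complex.I
  have hre : ∀ x, (h x).re = f₂ x - f₁ x := fun x => by simp [h]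
  have him : ∀ x, (h x).im = -(f₁ x + f₂ x) := fun x => by simp [h]
  have hcont : Continuous h := by fun_prop
  have h0 : ∀ x, h x ≠ 0 := fun x hx => by
    have h₁ := hre x
    have h₂ := him x
    rw [hx, Complex.zero_re] at h₁
    rw [hx, Complex.zero_im] at h₂
    exact hne x (by linarith) (by linarith)
  obtain ⟨g, ⟨-, hg⟩, -⟩ := Complex.isCoveringMapOn_exp.existsUnique_continuousMap_lifts
    (⟨h, hcont⟩ : C(X, ℂ)) (Complex.exp_log (h0 a)) h0
  have hexp : ∀ x, Complex.exp (g x) = h x := fun x => congrFun hg x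
  have hexp' : ∀ x, Complex.exp (g x + Real.pi * Complex.I) = -h x := fun x => by
    rw [Complex.exp_add, Complex.exp_pi_mul_I, hexp, mul_neg_one]
  have hincS := hS.sub_eq_log_exp_sub g.continuous.continuousOn (fun x hx => by
    rw [hexp, Complex.mem_slitPlane_iff, hre, him]
    by_contra! hc
    have := hfS x hx
    have := hne x
    grind) haS hbS
  have hincT := hT.sub_eq_log_exp_sub (g := fun x => g x + Real.pi * Complex.I)
    (g.continuous.add continuous_const).continuousOn (fun x hx => by
    rw [hexp', Complex.mem_slitPlane_iff, Complex.neg_re, Complex.neg_im, hre, him]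
    by_contra! hc
    have := hfT x hx
    have := hne x
    grind) haT hbT
  rw [hexp, hexp] at hincS
  rw [hexp', hexp', add_sub_add_right_eq_sub] at hincT
  have hS' := congrArg Complex.im hincS
  have hT' := congrArg Complex.im hincT
  simp only [Complex.sub_im, Complex.log_im] at hS' hT'
  have h₁ : (h b).arg < 0 := Complex.arg_neg_iff.2 (by rw [him]; linarith)
  have h₂ : 0 ≤ (h a).arg := Complex.arg_nonneg_iff.2 (by rw [him]; linarith)
  have h₃ : 0 ≤ (-h b).arg := Complex.arg_nonneg_iff.2 (by rw [Complex.neg_im, him]; linarith)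
  have h₄ : (-h a).arg < 0 := Complex.arg_neg_iff.2 (by rw [Complex.neg_im, him]; linarith)
  linarith

open Set in
/-- If `u` and `v` are negative at the left end and positive at the right end of an interval, and
all zeros of `u` lie below all zeros of `v`, then `u` is nonnegative wherever `v` is positive. -/
theorem nonneg_of_pos_of_sSup_zeros_lt_sInf_zeros {a b : ℝ} {u v : ℝ → ℝ}
    (hu : ContinuousOn u (Icc a b)) (hv : ContinuousOn v (Icc a b))
    (hva : v a < 0) (hub : 0 < u b)
    (hlt : sSup {t ∈ Icc a b | u t = 0} < sInf {t ∈ Icc a b | v t = 0})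
    {t : ℝ} (ht : t ∈ Icc a b) (hvt : 0 < v t) : 0 ≤ u t := by
  by_contra! hut
  obtain ⟨r, hr, hvr⟩ := intermediate_value_Icc ht.1
    (hv.mono (Icc_subset_Icc_right ht.2)) ⟨hva.le, hvt.le⟩
  obtain ⟨s, hs, hus⟩ := intermediate_value_Icc ht.2
    (hu.mono (Icc_subset_Icc_left ht.1)) ⟨hut.le, hub.le⟩
  have h₁ : s ≤ sSup {t ∈ Icc a b | u t = 0} :=
    le_csSup ⟨b, fun _ hz => hz.1.2⟩ ⟨⟨ht.1.trans hs.1, hs.2⟩, hus⟩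
  have h₂ : sInf {t ∈ Icc a b | v t = 0} ≤ r :=
    csInf_le ⟨a, fun _ hz => hz.1.1⟩ ⟨⟨hr.1, hr.2.trans ht.2⟩, hvr⟩
  linarith [hr.2, hs.1]


/-- A variant of the Poincaré–Miranda theorem: under sign conditions on the boundary
of the rectangle R = [x⁻, x⁺] × [y⁻, y⁺] and an ordering of the boundary zero sets
of f₁ and f₂, the map f = (f₁, f₂) has a zero in R. -/
theorem statement18 (xm xp ym yp : ℝ) (hx : xm < xp) (hy : ym < yp)
    (f₁ f₂ : ℝ × ℝ → ℝ)
    (hc₁ : ContinuousOn f₁ (Set.Icc xm xp ×ˢ Set.Icc ym yp))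
    (hc₂ : ContinuousOn f₂ (Set.Icc xm xp ×ˢ Set.Icc ym yp))
    (hleft : ∀ y ∈ Set.Icc ym yp, f₁ (xm, y) < 0 ∧ f₂ (xm, y) < 0)
    (hbottom : ∀ x ∈ Set.Icc xm xp, f₁ (x, ym) < 0 ∧ f₂ (x, ym) < 0)
    (hcorner : 0 < f₁ (xp, yp) ∧ 0 < f₂ (xp, yp))
    (htop : sSup {x ∈ Set.Icc xm xp | f₁ (x, yp) = 0} <
      sInf {x ∈ Set.Icc xm xp | f₂ (x, yp) = 0})
    (hright : sSup {y ∈ Set.Icc ym yp | f₂ (xp, y) = 0} <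
      sInf {y ∈ Set.Icc ym yp | f₁ (xp, y) = 0}) :
    ∃ q ∈ Set.Icc xm xp ×ˢ Set.Icc ym yp, f₁ q = 0 ∧ f₂ q = 0 := by
  let c : ℝ × ℝ → ℝ × ℝ := fun q => (max xm (min xp q.1), max ym (min yp q.2))
  have hc : Continuous c := by fun_prop
  have hcR : ∀ q, c q ∈ Set.Icc xm xp ×ˢ Set.Icc ym yp := fun q =>
    ⟨⟨le_max_left _ _, max_le hx.le (min_le_left _ _)⟩,
      ⟨le_max_left _ _, max_le hy.le (min_le_left _ _)⟩⟩
  have hcid : ∀ x ∈ Set.Icc xm xp, ∀ y ∈ Set.Icc ym yp, c (x, y) = (x, y) := fun x hx y hy => by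
    simp [c, hx.1, hx.2, hy.1, hy.2]
  have hxm := Set.left_mem_Icc.2 hx.le
  have hxp := Set.right_mem_Icc.2 hx.le
  have hym := Set.left_mem_Icc.2 hy.le
  have hyp := Set.right_mem_Icc.2 hy.le
  have hhor : ∀ y, IsPreconnected (Set.Icc xm xp ×ˢ ({y} : Set ℝ)) := fun y =>
    isPreconnected_Icc.prod isPreconnected_singleton
  have hver : ∀ x, IsPreconnected (({x} : Set ℝ) ×ˢ Set.Icc ym yp) := fun x =>
    isPreconnected_singleton.prod isPreconnected_Icc
  have htop_maps : Set.MapsTo (fun x => (x, yp)) (Set.Icc xm xp)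
      (Set.Icc xm xp ×ˢ Set.Icc ym yp) := fun _ h => ⟨h, hyp⟩
  have hright_maps : Set.MapsTo (fun y => (xp, y)) (Set.Icc ym yp)
      (Set.Icc xm xp ×ˢ Set.Icc ym yp) := fun _ h => ⟨hxp, h⟩
  obtain ⟨q, h₁, h₂⟩ := exists_common_zero_of_isPreconnected
    (hc₁.comp_continuous hc hcR) (hc₂.comp_continuous hc hcR)
    ((hhor ym).union (xp, ym) (Set.mk_mem_prod hxp (Set.mem_singleton _))
      (Set.mk_mem_prod (Set.mem_singleton _) hym) (hver xp))
    ((hver xm).union (xm, yp) (Set.mk_mem_prod (Set.mem_singleton _) hyp)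
      (Set.mk_mem_prod hxm (Set.mem_singleton _)) (hhor yp))
    (by
      rintro ⟨x, y⟩ (⟨hx', rfl : y = ym⟩ | ⟨rfl : x = xp, hy'⟩) hpos
      · rw [Function.comp_apply, hcid x hx' y hym] at hpos
        exact absurd hpos (hbottom x hx').1.not_gt
      · rw [Function.comp_apply, hcid x hxp y hy'] at hpos ⊢
        exact nonneg_of_pos_of_sSup_zeros_lt_sInf_zeros
          (hc₂.comp (by fun_prop) hright_maps) (hc₁.comp (by fun_prop) hright_maps)
          (hbottom x hxp).1 hcorner.2 hright hy' hpos)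
    (by
      rintro ⟨x, y⟩ (⟨rfl : x = xm, hy'⟩ | ⟨hx', rfl : y = yp⟩) hpos
      · rw [Function.comp_apply, hcid x hxm y hy'] at hpos
        exact absurd hpos (hleft y hy').2.not_gt
      · rw [Function.comp_apply, hcid x hx' y hyp] at hpos ⊢
        exact nonneg_of_pos_of_sSup_zeros_lt_sInf_zeros
          (hc₁.comp (by fun_prop) htop_maps) (hc₂.comp (by fun_prop) htop_maps)
          (hleft y hyp).2 hcorner.1 htop hx' hpos)
    (a := (xm, ym)) (b := (xp, yp))
    (Or.inl ⟨hxm, rfl⟩) (Or.inr ⟨rfl, hyp⟩) (Or.inl ⟨rfl, hym⟩) (Or.inr ⟨hxp, rfl⟩)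
    (by simpa only [Function.comp_apply, hcid xm hxm ym hym] using (hleft ym hym).1)
    (by simpa only [Function.comp_apply, hcid xm hxm ym hym] using (hleft ym hym).2)
    (by simpa only [Function.comp_apply, hcid xp hxp yp hyp] using hcorner.1)
    (by simpa only [Function.comp_apply, hcid xp hxp yp hyp] using hcorner.2)
  exact ⟨c q, hcR q, h₁, h₂⟩
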